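/- For each natural number k ≥ 1 and every real x ≥ k+1, the following double inequality holds: r_k(x) < (−1)^k · F(x)/Γ(x+2) ≤ (p_k(x)/(p_k(x) − (−1)^k))·r_k(x), where the right inequality is an equality if and only if x = k+1. -/

import Mathlib

open MeasureTheory

/-- The real part of the alternating Kurepa function:
`F(x) = ∫₀^∞ e^{−t} (t^{x+1} − cos(πx)·t)/(t+1) dt`, convergent for `x > −2`. -/
noncomputable def reAltKurepa (x : ℝ) : ℝ :=
  ∫ t in Set.Ioi (0 : ℝ), Real.exp (-t) * (t ^ (x + 1) - Real.cos (Real.pi * x) * t) / (t + 1)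

/-- The polynomials `pₙ` (real version), defined recursively by `p₀(z) = 1` and
`pₙ(z) = (z − n + 1)·pₙ₋₁(z) + (−1)ⁿ` for `n ≥ 1`. -/
noncomputable def kurepaP : ℕ → ℝ → ℝ
  | 0, _ => 1
  | (n + 1), z => (z - ((n : ℝ) + 1) + 1) * kurepaP n z + (-1 : ℝ) ^ (n + 1)

/-- The rational functions `rₙ` (real version): `r₁(z) = −1/(z+1)`, `r₂(z) = (z−1)/(z(z+1))`,
and `rₙ(z) = −((z−n+1)/(z−n+2))·rₙ₋₁(z) + (1/(z−n+2))·rₙ₋₂(z)` for `n ≥ 3`.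
(The value of `r₀` is an irrelevant junk value.) -/
noncomputable def kurepaR : ℕ → ℝ → ℝ
  | 0, _ => 0
  | 1, z => -1 / (z + 1)
  | 2, z => (z - 1) / (z * (z + 1))
  | (n + 3), z =>
      -((z - ((n : ℝ) + 3) + 1) / (z - ((n : ℝ) + 3) + 2)) * kurepaR (n + 2) z +
        (1 / (z - ((n : ℝ) + 3) + 2)) * kurepaR (n + 1) z

/-- A function on a convex set whose derivative changes sign from nonpositive to nonnegative at
`r` attains its minimum at `r`. -/
lemma le_of_sub_mul_hasDerivAt_nonneg {f f' : ℝ → ℝ} {s : Set ℝ} (hs : Convex ℝ s)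
    (hf : ∀ t ∈ s, HasDerivAt f (f' t) t) {r : ℝ} (hr : r ∈ s)
    (hsign : ∀ t ∈ s, 0 ≤ (t - r) * f' t) {t : ℝ} (ht : t ∈ s) : f r ≤ f t := by
  rcases lt_trichotomy r t with h | rfl | h
  · have hsub : Set.Icc r t ⊆ s := hs.ordConnected.out hr ht
    obtain ⟨c, hc, hc'⟩ := exists_hasDerivAt_eq_slope f f' h
      (fun u hu => (hf u (hsub hu)).continuousAt.continuousWithinAt)
      (fun u hu => hf u (hsub (Set.Ioo_subset_Icc_self hu)))
    have h0 := nonneg_of_mul_nonneg_right (hsign c (hsub (Set.Ioo_subset_Icc_self hc)))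
      (sub_pos.2 hc.1)
    rw [hc', le_div_iff₀ (sub_pos.2 h)] at h0
    linarith
  · exact le_rfl
  · have hsub : Set.Icc t r ⊆ s := hs.ordConnected.out ht hr
    obtain ⟨c, hc, hc'⟩ := exists_hasDerivAt_eq_slope f f' h
      (fun u hu => (hf u (hsub hu)).continuousAt.continuousWithinAt)
      (fun u hu => hf u (hsub (Set.Ioo_subset_Icc_self hu)))
    have h0 := nonpos_of_mul_nonneg_right (hsign c (hsub (Set.Ioo_subset_Icc_self hc)))
      (sub_neg.2 hc.2)
    rw [hc', div_le_iff₀ (sub_pos.2 h)] at h0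
    linarith

lemma log_three_le : Real.log 3 ≤ 1223 / 9864 + 39 / 40 := by
  rw [Real.log_le_iff_le_exp (by norm_num)]
  refine le_trans ?_ (Real.sum_le_exp_of_nonneg (by norm_num) 10)
  norm_num [Finset.sum_range_succ, Nat.factorial]

/-- A Laurent polynomial minorant of the logarithm, nearly touching it at `1/3`, `2` and `16/3`. -/
noncomputable def logMinorant (t : ℝ) : ℝ :=
  -(80 / 411) / t - 39 / 40 + 2497 / 1644 * t - 963 / 2192 * t ^ 2 + 75 / 1096 * t ^ 3
    - 9 / 2192 * t ^ 4

lemma hasDerivAt_log_sub_logMinorant {t : ℝ} (ht : 0 < t) :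
    HasDerivAt (fun u => Real.log u - logMinorant u)
      (9 / 548 / t ^ 2 * ((t - 1 / 3) * (t - 5 / 6) * (t - 2) * (t - 4) * (t - 16 / 3))) t := by
  have h1 := (hasDerivAt_inv ht.ne').const_mul (-(80 / 411) : ℝ)
  have h2 := (hasDerivAt_id t).const_mul (2497 / 1644 : ℝ)
  have h3 := (hasDerivAt_pow 2 t).const_mul (963 / 2192 : ℝ)
  have h4 := (hasDerivAt_pow 3 t).const_mul (75 / 1096 : ℝ)
  have h5 := (hasDerivAt_pow 4 t).const_mul (9 / 2192 : ℝ)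
  have h := (Real.hasDerivAt_log ht.ne').sub
    (((((h1.sub_const (39 / 40 : ℝ)).add h2).sub h3).add h4).sub h5)
  refine (h.congr_of_eventuallyEq (.of_forall fun u => ?_)).congr_deriv ?_
  · simp only [logMinorant, Pi.sub_apply, Pi.add_apply, id_eq]
    ring
  · field_simp
    ring

lemma logMinorant_le_log {t : ℝ} (ht : 0 < t) : logMinorant t ≤ Real.log t := by
  have hlog2 := Real.log_two_gt_d9
  have hlog3 := log_three_le
  rw [← sub_nonneg]
  rcases le_total t (5 / 6) with h | h
  · refine le_trans ?_ (le_of_sub_mul_hasDerivAt_nonneg (s := Set.Ioc 0 (5 / 6)) (r := 1 / 3)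
      (convex_Ioc _ _) (fun u hu => hasDerivAt_log_sub_logMinorant hu.1)
      (by norm_num) (fun u hu => ?_) ⟨ht, h⟩)
    · rw [one_div, Real.log_inv, logMinorant]
      norm_num at hlog3 ⊢
      linarith
    · have h2 := hu.2
      calc (0 : ℝ) ≤ 9 / 548 / u ^ 2 * ((u - 1 / 3) ^ 2 *
            (((5 / 6 - u) * (2 - u)) * ((4 - u) * (16 / 3 - u)))) :=
          mul_nonneg (by positivity) (mul_nonneg (sq_nonneg _) (mul_nonneg
            (mul_nonneg (by linarith) (by linarith)) (mul_nonneg (by linarith) (by linarith))))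
        _ = _ := by ring
  rcases le_total t 4 with h' | h'
  · refine le_trans ?_ (le_of_sub_mul_hasDerivAt_nonneg (s := Set.Icc (5 / 6) 4) (r := 2)
      (convex_Icc _ _) (fun u hu => hasDerivAt_log_sub_logMinorant (by linarith [hu.1]))
      (by norm_num) (fun u hu => ?_) ⟨h, h'⟩)
    · rw [logMinorant]
      norm_num at hlog2 ⊢
      linarith
    · obtain ⟨h1, h2⟩ := hu
      calc (0 : ℝ) ≤ 9 / 548 / u ^ 2 * ((u - 2) ^ 2 *
            (((u - 1 / 3) * (u - 5 / 6)) * ((4 - u) * (16 / 3 - u)))) :=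
          mul_nonneg (by positivity) (mul_nonneg (sq_nonneg _) (mul_nonneg
            (mul_nonneg (by linarith) (by linarith)) (mul_nonneg (by linarith) (by linarith))))
        _ = _ := by ring
  · refine le_trans ?_ (le_of_sub_mul_hasDerivAt_nonneg (s := Set.Ici 4) (r := 16 / 3)
      (convex_Ici _) (fun u hu => hasDerivAt_log_sub_logMinorant (by linarith [Set.mem_Ici.1 hu]))
      (by norm_num [Set.mem_Ici]) (fun u hu => ?_) h')
    · rw [Real.log_div (by norm_num) (by norm_num), show (16 : ℝ) = 2 ^ 4 by norm_num,
        Real.log_pow, logMinorant]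
      norm_num at hlog2 hlog3 ⊢
      linarith
    · have h1 := Set.mem_Ici.1 hu
      calc (0 : ℝ) ≤ 9 / 548 / u ^ 2 * ((u - 16 / 3) ^ 2 *
            (((u - 1 / 3) * (u - 5 / 6)) * ((u - 2) * (u - 4)))) :=
          mul_nonneg (by positivity) (mul_nonneg (sq_nonneg _) (mul_nonneg
            (mul_nonneg (by linarith) (by linarith)) (mul_nonneg (by linarith) (by linarith))))
        _ = _ := by ring

/-- A polynomial minorant of `t * log t / (t + 1)`. -/
noncomputable def mulLogMinorant (t : ℝ) : ℝ :=
  -20799808 / 89764455 - 320810173 / 718115640 * t + 165180187 / 143623128 * t ^ 2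
    - 934064539 / 1436231280 * t ^ 3 + 264824677 / 1436231280 * t ^ 4
    - 10005331 / 359057820 * t ^ 5 + 23107 / 10880540 * t ^ 6 - 23107 / 359057820 * t ^ 7

lemma mulLogMinorant_le {t : ℝ} (ht : 0 < t) :
    mulLogMinorant t ≤ t * Real.log t / (t + 1) := by
  have h : t * logMinorant t / (t + 1) - mulLogMinorant t = 23107 / 8220 *
      (t ^ 4 - 16 * t ^ 3 + 72 * t ^ 2 - 96 * t + 24) ^ 2 / (209 ^ 2 * (t + 1)) := by
    unfold logMinorant mulLogMinorant
    field_simp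
    ring
  have h0 : 0 ≤ t * logMinorant t / (t + 1) - mulLogMinorant t := by
    rw [h]; positivity
  have h1 : t * logMinorant t / (t + 1) ≤ t * Real.log t / (t + 1) := by
    gcongr
    exact logMinorant_le_log ht
  linarith

lemma integrableOn_exp_neg_mul_pow (n : ℕ) :
    IntegrableOn (fun t : ℝ => Real.exp (-t) * t ^ n) (Set.Ioi 0) := by
  refine (Real.GammaIntegral_convergent (s := n + 1) (by positivity)).congr_fun
    (fun t _ => ?_) measurableSet_Ioi
  simp

lemma integral_exp_neg_mul_pow (n : ℕ) :
    ∫ t in Set.Ioi (0 : ℝ), Real.exp (-t) * t ^ n = n.factorial := by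
  rw [← Real.Gamma_nat_eq_factorial, Real.Gamma_eq_integral (by positivity)]
  simp

lemma exp_neg_mul_mulLogMinorant (t : ℝ) : Real.exp (-t) * mulLogMinorant t =
    ∑ i : Fin 8, ![-20799808 / 89764455, -320810173 / 718115640, 165180187 / 143623128,
      -934064539 / 1436231280, 264824677 / 1436231280, -10005331 / 359057820,
      23107 / 10880540, -23107 / 359057820] i * (Real.exp (-t) * t ^ (i : ℕ)) := by
  simp [Fin.sum_univ_succ, mulLogMinorant]
  ring

lemma integrableOn_exp_neg_mul_mulLogMinorant :
    IntegrableOn (fun t => Real.exp (-t) * mulLogMinorant t) (Set.Ioi 0) := by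
  simp_rw [exp_neg_mul_mulLogMinorant]
  exact integrable_finsetSum _ fun i _ => (integrableOn_exp_neg_mul_pow i).const_mul _

lemma integral_exp_neg_mul_mulLogMinorant_pos :
    0 < ∫ t in Set.Ioi (0 : ℝ), Real.exp (-t) * mulLogMinorant t := by
  simp_rw [exp_neg_mul_mulLogMinorant]
  rw [integral_finsetSum Finset.univ fun (i : Fin 8) _ => (integrableOn_exp_neg_mul_pow i).const_mul _]
  simp_rw [integral_const_mul, integral_exp_neg_mul_pow]
  simp [Fin.sum_univ_succ, Nat.factorial]
  norm_num

lemma integrableOn_exp_neg_mul_rpow_div {x : ℝ} (hx : -2 < x) :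
    IntegrableOn (fun t : ℝ => Real.exp (-t) * t ^ (x + 1) / (t + 1)) (Set.Ioi 0) := by
  have h := Real.GammaIntegral_convergent (s := x + 2) (by linarith)
  rw [show x + 2 - 1 = x + 1 by ring] at h
  refine h.mono' (Measurable.aestronglyMeasurable (by fun_prop)) ?_
  filter_upwards [ae_restrict_mem measurableSet_Ioi] with t ht
  have ht : (0 : ℝ) < t := ht
  rw [Real.norm_of_nonneg (by positivity)]
  exact div_le_self (by positivity) (by linarith)

lemma integrableOn_reAltKurepa {x : ℝ} (hx : -2 < x) : IntegrableOn (fun t : ℝ =>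
    Real.exp (-t) * (t ^ (x + 1) - Real.cos (Real.pi * x) * t) / (t + 1)) (Set.Ioi 0) := by
  have h0 := (integrableOn_exp_neg_mul_rpow_div (x := 0) (by norm_num)).const_mul
    (Real.cos (Real.pi * x))
  refine ((integrableOn_exp_neg_mul_rpow_div hx).sub h0).congr_fun (fun t _ => ?_)
    measurableSet_Ioi
  simp only [Pi.sub_apply, zero_add, Real.rpow_one]
  ring

lemma reAltKurepa_add_reAltKurepa_sub_one {x : ℝ} (hx : -1 < x) :
    reAltKurepa x + reAltKurepa (x - 1) = Real.Gamma (x + 1) := by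
  unfold reAltKurepa
  rw [← integral_add (integrableOn_reAltKurepa (by linarith))
    (integrableOn_reAltKurepa (by linarith)), Real.Gamma_eq_integral (by linarith)]
  refine setIntegral_congr_fun measurableSet_Ioi fun t ht => ?_
  have ht : (0 : ℝ) < t := ht
  have hcos : Real.cos (Real.pi * (x - 1)) = -Real.cos (Real.pi * x) := by
    rw [mul_sub, mul_one, Real.cos_sub_pi]
  simp only [hcos, sub_add_cancel, add_sub_cancel_right, Real.rpow_add_one ht.ne']
  field_simp
  ring

lemma reAltKurepa_zero : reAltKurepa 0 = 0 := by
  simp [reAltKurepa]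

lemma reAltKurepa_one : reAltKurepa 1 = 1 := by
  have h := reAltKurepa_add_reAltKurepa_sub_one (x := 1) (by norm_num)
  rw [sub_self, reAltKurepa_zero, add_zero, one_add_one_eq_two, Real.Gamma_two] at h
  exact h

lemma reAltKurepa_pos {x : ℝ} (hx : 0 < x) : 0 < reAltKurepa x := by
  refine (mul_pos hx integral_exp_neg_mul_mulLogMinorant_pos).trans_le ?_
  rw [← integral_const_mul]
  refine setIntegral_mono_on (integrableOn_exp_neg_mul_mulLogMinorant.const_mul x)
    (integrableOn_reAltKurepa (by linarith)) measurableSet_Ioi fun t ht => ?_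
  have ht : (0 : ℝ) < t := ht
  have hpow : 1 + x * Real.log t ≤ t ^ x := by
    rw [Real.rpow_def_of_pos ht]
    linarith [Real.add_one_le_exp (Real.log t * x)]
  calc x * (Real.exp (-t) * mulLogMinorant t)
      ≤ x * (Real.exp (-t) * (t * Real.log t / (t + 1))) := by
        gcongr
        exact mulLogMinorant_le ht
    _ = Real.exp (-t) * (x * Real.log t * t) / (t + 1) := by ring
    _ ≤ _ := by
        rw [Real.rpow_add_one ht.ne', ← sub_mul]
        gcongr
        linarith [Real.cos_le_one (Real.pi * x)]

lemma kurepaR_succ_add_mul_Gamma (n : ℕ) {x : ℝ} (hx : (n : ℝ) < x) :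
    (kurepaR (n + 1) x + kurepaR n x) * Real.Gamma (x + 2) = -Real.Gamma (x + 1 - n) := by
  have hstep (y : ℝ) (hy : 0 < y) : Real.Gamma (y + 1) = y * Real.Gamma y :=
    Real.Gamma_add_one hy.ne'
  induction n with
  | zero =>
    simp only [Nat.cast_zero] at hx
    rw [show x + 2 = x + 1 + 1 by ring, hstep (x + 1) (by linarith)]
    simp only [kurepaR, Nat.cast_zero]
    field_simp
    simp
  | succ n ih =>
    push_cast at hx ⊢
    have hn : (0 : ℝ) ≤ n := n.cast_nonneg
    specialize ih (by linarith)
    rcases n with _ | n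
    · simp only [Nat.cast_zero, zero_add] at hx ⊢
      rw [show x + 2 = x + 1 + 1 by ring, hstep (x + 1) (by linarith), hstep x (by linarith),
        add_sub_cancel_right]
      have : x ≠ 0 := by linarith
      simp only [kurepaR]
      field_simp
      ring
    · push_cast at hx ih ⊢
      have hne : 0 < x - ((n : ℝ) + 3) + 2 := by linarith
      rw [show x + 1 - ((n : ℝ) + 1) = x - ((n : ℝ) + 3) + 2 + 1 by ring, hstep _ hne] at ih
      rw [show x + 1 - ((n : ℝ) + 1 + 1) = x - ((n : ℝ) + 3) + 2 by ring]
      have hrec : (x - ((n : ℝ) + 3) + 2) * (kurepaR (n + 1 + 1 + 1) x + kurepaR (n + 1 + 1) x)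
          = kurepaR (n + 1 + 1) x + kurepaR (n + 1) x := by
        rw [kurepaR]
        field_simp
        ring
      rw [← hrec] at ih
      refine mul_left_cancel₀ hne.ne' ?_
      linear_combination ih

lemma neg_one_pow_mul_reAltKurepa (n : ℕ) {x : ℝ} (hx : (n : ℝ) - 1 < x) :
    (-1) ^ n * reAltKurepa x = kurepaR n x * Real.Gamma (x + 2) + reAltKurepa (x - n) := by
  induction n with
  | zero => simp [kurepaR]
  | succ n ih =>
    push_cast at hx
    have h1 := reAltKurepa_add_reAltKurepa_sub_one (x := x - n) (by linarith)
    have h2 := kurepaR_succ_add_mul_Gamma n (x := x) (by linarith)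
    specialize ih (by linarith)
    push_cast
    rw [show x - n + 1 = x + 1 - n by ring, show x - n - 1 = x - (n + 1) by ring] at h1
    rw [pow_succ]
    linear_combination -ih - h2 - h1

lemma kurepaR_succ_mul_Gamma (n : ℕ) {x : ℝ} (hx : (n : ℝ) < x) :
    kurepaR (n + 1) x * Real.Gamma (x + 2) =
      (-1) ^ (n + 1) * kurepaP n x * Real.Gamma (x + 1 - n) := by
  induction n with
  | zero =>
    have h := kurepaR_succ_add_mul_Gamma 0 hx
    simpa [kurepaR, kurepaP] using h
  | succ n ih =>
    have h := kurepaR_succ_add_mul_Gamma (n + 1) hx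
    push_cast at hx h ⊢
    specialize ih (by linarith)
    rw [show x + 1 - ((n : ℝ) + 1) = x - n by ring] at h ⊢
    rw [show x + 1 - (n : ℝ) = x - n + 1 by ring, Real.Gamma_add_one (by linarith)] at ih
    have hsq : ((-1 : ℝ) ^ n) * (-1) ^ n = 1 := by rw [← mul_pow]; norm_num
    rw [kurepaP]
    simp only [pow_succ] at ih ⊢
    linear_combination h - ih + Real.Gamma (x - n) * hsq

lemma one_le_kurepaP (n : ℕ) {x : ℝ} (hx : (n : ℝ) + 1 ≤ x) : 1 ≤ kurepaP n x := by
  induction n with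
  | zero => simp [kurepaP]
  | succ n ih =>
    push_cast at hx
    specialize ih (by linarith)
    rw [kurepaP]
    have h := neg_le_of_abs_le (abs_neg_one_pow (α := ℝ) (n + 1)).le
    nlinarith

/-- For each `k ≥ 1` and every real `x ≥ k+1`:
`r_k(x) < (−1)^k·F(x)/Γ(x+2) ≤ (p_k(x)/(p_k(x) − (−1)^k))·r_k(x)`, where the right
inequality is an equality iff `x = k+1`. -/
theorem reAltKurepa_div_gamma_bounds (k : ℕ) (hk : 1 ≤ k) (x : ℝ) (hx : (k : ℝ) + 1 ≤ x) :
    kurepaR k x < (-1 : ℝ) ^ k * (reAltKurepa x / Real.Gamma (x + 2)) ∧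
    (-1 : ℝ) ^ k * (reAltKurepa x / Real.Gamma (x + 2)) ≤
      (kurepaP k x / (kurepaP k x - (-1 : ℝ) ^ k)) * kurepaR k x ∧
    ((-1 : ℝ) ^ k * (reAltKurepa x / Real.Gamma (x + 2)) =
      (kurepaP k x / (kurepaP k x - (-1 : ℝ) ^ k)) * kurepaR k x ↔ x = (k : ℝ) + 1) := by
  obtain ⟨n, rfl⟩ : ∃ n, k = n + 1 := ⟨k - 1, by lia⟩
  push_cast at hx ⊢
  set y : ℝ := x - (n + 1) with hy
  have hy1 : 1 ≤ y := by linarith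
  have hn : (0 : ℝ) ≤ n := n.cast_nonneg
  have hG : 0 < Real.Gamma (x + 2) := Real.Gamma_pos_of_pos (by linarith)
  have hF : (-1 : ℝ) ^ (n + 1) * (reAltKurepa x / Real.Gamma (x + 2)) =
      kurepaR (n + 1) x + reAltKurepa y / Real.Gamma (x + 2) := by
    have h := neg_one_pow_mul_reAltKurepa (n + 1) (x := x) (by push_cast; linarith)
    push_cast at h
    rw [← hy] at h
    rw [← mul_div_assoc, h, add_div, mul_div_cancel_right₀ _ hG.ne']
  have hU : kurepaP (n + 1) x / (kurepaP (n + 1) x - (-1) ^ (n + 1)) * kurepaR (n + 1) x =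
      kurepaR (n + 1) x + Real.Gamma (y + 1) / Real.Gamma (x + 2) := by
    have hP := one_le_kurepaP n (x := x) (by linarith)
    have hR := kurepaR_succ_mul_Gamma n (x := x) (by linarith)
    have hsq : ((-1 : ℝ) ^ (n + 1)) * (-1) ^ (n + 1) = 1 := by rw [← mul_pow]; norm_num
    rw [show x + 1 - (n : ℝ) = y + 1 + 1 by rw [hy]; ring,
      Real.Gamma_add_one (by linarith)] at hR
    have hD : kurepaP (n + 1) x - (-1) ^ (n + 1) = (y + 1) * kurepaP n x := by
      rw [kurepaP, hy]; ring
    have hD0 : kurepaP (n + 1) x - (-1) ^ (n + 1) ≠ 0 := by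
      rw [hD]
      positivity
    field_simp
    linear_combination (-1) ^ (n + 1) * hR - Real.Gamma (y + 1) * hD +
      (y + 1) * kurepaP n x * Real.Gamma (y + 1) * hsq
  have hpos : 0 < reAltKurepa y := reAltKurepa_pos (by linarith)
  have hrec := reAltKurepa_add_reAltKurepa_sub_one (x := y) (by linarith)
  have hx_iff : x = (n : ℝ) + 1 + 1 ↔ y = 1 := by
    constructor <;> intro h <;> linarith
  rw [hF, hU, hx_iff, add_right_inj, div_left_inj' hG.ne', lt_add_iff_pos_right,
    add_le_add_iff_left, div_le_div_iff_of_pos_right hG]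
  refine ⟨by positivity, ?_⟩
  rcases hy1.eq_or_lt with h | h
  · rw [← h, reAltKurepa_one, one_add_one_eq_two, Real.Gamma_two]
    simp
  · have h0 : 0 < reAltKurepa (y - 1) := reAltKurepa_pos (by linarith)
    exact ⟨by linarith, fun he => by linarith, fun he => by linarith⟩
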